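/- Let G be a uniformly random matrix in F_2^{n×d} and let ε > 0. Then the probability that there exists a nonzero z ∈ F_2^d with |bias(Gz)| > ε is at most 2^{d+1} · e^{-ε²n/2}. -/

import Mathlib

open Finset
open scoped Classical

noncomputable section

/-- The character `(-1)^b` of a bit `b ∈ F_2`, valued in `ℝ`. -/
def chi (b : ZMod 2) : ℝ := (-1 : ℝ) ^ b.val

/-- The `F_2` inner product `⟨v,w⟩ = ∑ i, v i * w i`. -/
def ip {n : ℕ} (v w : Fin n → ZMod 2) : ZMod 2 := ∑ i, v i * w i

/-- Hamming weight of a vector in `F_2^n`. -/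
def wt {n : ℕ} (v : Fin n → ZMod 2) : ℕ := (univ.filter fun i => v i ≠ 0).card

/-- `bias(v) = (1/n) ∑ i, (-1)^(v i)`. -/
def bias {n : ℕ} (v : Fin n → ZMod 2) : ℝ := (∑ i, chi (v i)) / n

/-- `bias(S, x) = (1/|S|) ∑_{w ∈ S} (-1)^⟨w,x⟩`. -/
def biasS {n : ℕ} (S : Finset (Fin n → ZMod 2)) (x : Fin n → ZMod 2) : ℝ :=
  (∑ w ∈ S, chi (ip w x)) / S.card

/-- `S_{t,n}`: the set of Hamming-weight-`t` vectors in `F_2^n`. -/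
def sphere (n t : ℕ) : Finset (Fin n → ZMod 2) := univ.filter fun w => wt w = t

/-- Probability of an event under the uniform distribution on a finite type. -/
def probOf {α : Type*} [Fintype α] (P : α → Prop) : ℝ :=
  ((univ.filter P).card : ℝ) / (Fintype.card α : ℝ)

theorem exp_mul_chi_add_exp_mul_chi_add_one (s : ℝ) (b : ZMod 2) :
    Real.exp (s * chi b) + Real.exp (s * chi (b + 1)) = 2 * Real.cosh s := by
  have h : b = 0 ∨ b = 1 := by revert b; decide
  have h0 : chi 0 = 1 := by simp [chi]
  have h1 : chi 1 = -1 := by simp [chi, ZMod.val_one]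
  have h2 : (1 + 1 : ZMod 2) = 0 := by decide
  rw [Real.cosh_eq]
  rcases h with rfl | rfl
  · rw [zero_add, h0, h1, mul_one, mul_neg_one]; ring
  · rw [h2, h0, h1, mul_one, mul_neg_one]; ring

/-- The exponential moment of `(-1)^⟨r, z⟩` over a uniformly random row `r`, for `z ≠ 0`. -/
theorem sum_exp_mul_chi_dotProduct {d : ℕ} (s : ℝ) {z : Fin d → ZMod 2} (hz : z ≠ 0) :
    ∑ r : Fin d → ZMod 2, Real.exp (s * chi (r ⬝ᵥ z)) =
      Fintype.card (Fin d → ZMod 2) * Real.cosh s := by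
  obtain ⟨j, hj⟩ := Function.ne_iff.mp hz
  have hj1 : z j = 1 := by
    have h : ∀ b : ZMod 2, b ≠ 0 → b = 1 := by decide
    exact h _ hj
  have hshift := Equiv.sum_comp (Equiv.addRight (Pi.single j 1 : Fin d → ZMod 2))
    fun r => Real.exp (s * chi (r ⬝ᵥ z))
  simp only [Equiv.coe_addRight, add_dotProduct, single_dotProduct, hj1, mul_one] at hshift
  have hpair : ∑ r : Fin d → ZMod 2,
      (Real.exp (s * chi (r ⬝ᵥ z)) + Real.exp (s * chi (r ⬝ᵥ z + 1))) =
        Fintype.card (Fin d → ZMod 2) * (2 * Real.cosh s) := by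
    simp_rw [exp_mul_chi_add_exp_mul_chi_add_one, sum_const, nsmul_eq_mul, card_univ]
  rw [sum_add_distrib, hshift] at hpair
  linarith

/-- The exponential moment of `∑ i, (-1)^((Gz) i)` over a uniformly random matrix `G`. -/
theorem sum_exp_mul_sum_chi_mulVec {n d : ℕ} (s : ℝ) {z : Fin d → ZMod 2} (hz : z ≠ 0) :
    ∑ G : Matrix (Fin n) (Fin d) (ZMod 2),
        Real.exp (s * ∑ i, chi (Matrix.mulVec G z i)) =
      Fintype.card (Matrix (Fin n) (Fin d) (ZMod 2)) * Real.cosh s ^ n := by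
  have hcard : Fintype.card (Matrix (Fin n) (Fin d) (ZMod 2)) =
      Fintype.card (Fin d → ZMod 2) ^ n := by
    change Fintype.card (Fin n → Fin d → ZMod 2) = _
    simp only [Fintype.card_fun, Fintype.card_fin]
  rw [hcard, Nat.cast_pow, ← mul_pow, ← sum_exp_mul_chi_dotProduct s hz, Fintype.sum_pow]
  simp_rw [mul_sum, Real.exp_sum]
  rfl

theorem probOf_lt_abs_bias_mulVec_le {n d : ℕ} {ε : ℝ} (hε : 0 < ε) {z : Fin d → ZMod 2}
    (hz : z ≠ 0) :
    probOf (fun G : Matrix (Fin n) (Fin d) (ZMod 2) => ε < |bias (Matrix.mulVec G z)|) ≤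
      2 * Real.exp (-(ε ^ 2 * n / 2)) := by
  have hpoint : ∀ G : Matrix (Fin n) (Fin d) (ZMod 2), ε < |bias (Matrix.mulVec G z)| →
      Real.exp (ε ^ 2 * n) ≤ Real.exp (ε * ∑ i, chi (Matrix.mulVec G z i)) +
        Real.exp (-ε * ∑ i, chi (Matrix.mulVec G z i)) := by
    intro G hG
    set S := ∑ i, chi (Matrix.mulVec G z i) with hS
    have hn : (0 : ℝ) < n := by
      refine (Nat.cast_nonneg n).lt_of_ne fun h => ?_
      rw [bias, ← h, div_zero, abs_zero] at hG
      linarith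
    rw [bias, ← hS, abs_div, Nat.abs_cast, lt_div_iff₀ hn] at hG
    have hle : ε ^ 2 * n ≤ ε * |S| := by nlinarith
    refine (Real.exp_le_exp.mpr hle).trans ?_
    rcases abs_choice S with h | h
    · rw [h]; linarith [Real.exp_pos (-ε * S)]
    · rw [h, mul_neg, ← neg_mul]; linarith [Real.exp_pos (ε * S)]
  have hcount : ((univ.filter fun G : Matrix (Fin n) (Fin d) (ZMod 2) =>
        ε < |bias (Matrix.mulVec G z)|).card : ℝ) * Real.exp (ε ^ 2 * n) ≤
      2 * (Fintype.card (Matrix (Fin n) (Fin d) (ZMod 2)) * Real.cosh ε ^ n) := by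
    rw [← nsmul_eq_mul]
    refine (card_nsmul_le_sum _ _ _ fun G hG => hpoint G (mem_filter.mp hG).2).trans ?_
    refine (sum_le_univ_sum_of_nonneg fun G => by positivity).trans_eq ?_
    rw [sum_add_distrib, sum_exp_mul_sum_chi_mulVec ε hz, sum_exp_mul_sum_chi_mulVec (-ε) hz,
      Real.cosh_neg, two_mul]
  have hcosh : Real.cosh ε ^ n ≤ Real.exp (-(ε ^ 2 * n / 2)) * Real.exp (ε ^ 2 * n) := by
    refine (pow_le_pow_left₀ (Real.cosh_pos ε).le (Real.cosh_le_exp_half_sq ε) n).trans_eq ?_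
    rw [← Real.exp_nat_mul, ← Real.exp_add]
    ring_nf
  rw [probOf, div_le_iff₀ (Nat.cast_pos.mpr Fintype.card_pos)]
  refine le_of_mul_le_mul_right (hcount.trans ?_) (Real.exp_pos (ε ^ 2 * n))
  calc _ ≤ 2 * ((Fintype.card (Matrix (Fin n) (Fin d) (ZMod 2)) : ℝ) *
        (Real.exp (-(ε ^ 2 * n / 2)) * Real.exp (ε ^ 2 * n))) := by gcongr
    _ = _ := by ring

theorem probOf_exists_le_sum {α ι : Type*} [Fintype α] (s : Finset ι) (P : ι → α → Prop) :
    probOf (fun a => ∃ i ∈ s, P i a) ≤ ∑ i ∈ s, probOf (P i) := by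
  simp only [probOf]
  rw [← sum_div]
  gcongr
  refine (Nat.cast_le.mpr (card_le_card (t := s.biUnion fun i => univ.filter (P i))
    fun a ha => ?_)).trans ?_
  · simpa using ha
  · exact_mod_cast card_biUnion_le

/-- For a uniformly random `G ∈ F_2^{n×d}` and `ε > 0`, the probability that
some nonzero `z ∈ F_2^d` has `|bias(Gz)| > ε` is at most `2^{d+1}·e^{-ε²n/2}`. -/
theorem random_code_balanced {n d : ℕ} (ε : ℝ) (hε : 0 < ε) :
    probOf (fun G : Matrix (Fin n) (Fin d) (ZMod 2) =>
        ∃ z : Fin d → ZMod 2, z ≠ 0 ∧ ε < |bias (Matrix.mulVec G z)|) ≤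
      (2 : ℝ) ^ (d + 1) * Real.exp (-(ε ^ 2 * n / 2)) := by
  have hunion := probOf_exists_le_sum (univ.filter fun z : Fin d → ZMod 2 => z ≠ 0)
    fun z (G : Matrix (Fin n) (Fin d) (ZMod 2)) => ε < |bias (Matrix.mulVec G z)|
  simp only [mem_filter, mem_univ, true_and] at hunion
  refine hunion.trans ((sum_le_card_nsmul _ _ _ fun z hz =>
    probOf_lt_abs_bias_mulVec_le hε (mem_filter.mp hz).2).trans ?_)
  have hcard : ((univ.filter fun z : Fin d → ZMod 2 => z ≠ 0).card : ℝ) ≤ 2 ^ d := by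
    have h := card_le_univ (univ.filter fun z : Fin d → ZMod 2 => z ≠ 0)
    rw [Fintype.card_fun, ZMod.card, Fintype.card_fin] at h
    exact_mod_cast h
  rw [nsmul_eq_mul, pow_succ (2 : ℝ) d, mul_assoc]
  exact mul_le_mul_of_nonneg_right hcard (by positivity)
end
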